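/- For every fixed λ ∈ (0,1), the functions k ↦ μ₁(λ,k) and k ↦ μ₂(λ,k) are strictly increasing on (0, +∞), where μ₁(λ,k) = (T(λ,k) − √(T(λ,k)² − 4D(λ,k)))/2 − 2 and μ₂(λ,k) = (T(λ,k) + √(T(λ,k)² − 4D(λ,k)))/2 − 2. -/

import Mathlib

open Set Filter
open scoped Topology

noncomputable section

/-- `R(λ)² = (1 - λ²)/(-2 log λ)`. -/
def Rsq (l : ℝ) : ℝ := (1 - l^2)/(-2*Real.log l)

/-- `ω(λ,k) = -k log λ`. -/
def om (l k : ℝ) : ℝ := -(k * Real.log l)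

/-- The hyperbolic cotangent. -/
def cothR (x : ℝ) : ℝ := Real.cosh x / Real.sinh x

/-- `c^i_λ = R(λ)²/λ - λ`. -/
def cI (l : ℝ) : ℝ := Rsq l / l - l

/-- `c^o_λ = 1 - R(λ)²`. -/
def cO (l : ℝ) : ℝ := 1 - Rsq l

/-- The trace `T(λ,k) = R²(1/λ² - 1) k coth ω + 2 - R² - R²/λ²` of `M̃_{λ,k}`. -/
def Tfun (l k : ℝ) : ℝ :=
  Rsq l * (1/l^2 - 1) * k * cothR (om l k) + 2 - Rsq l - Rsq l/l^2

/-- The determinant `D(λ,k) = (R²/λ² - 1)(1 - R²)(k² - 1)` of `M̃_{λ,k}`. -/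
def Dfun (l k : ℝ) : ℝ := (Rsq l/l^2 - 1) * (1 - Rsq l) * (k^2 - 1)

/-- The smaller eigenvalue `μ₁(λ,k) = (T - √(T² - 4D))/2 - 2` of `M_{λ,k}`. -/
def mu1 (l k : ℝ) : ℝ :=
  (Tfun l k - Real.sqrt ((Tfun l k)^2 - 4*Dfun l k))/2 - 2

/-- The larger eigenvalue `μ₂(λ,k) = (T + √(T² - 4D))/2 - 2` of `M_{λ,k}`. -/
def mu2 (l k : ℝ) : ℝ :=
  (Tfun l k + Real.sqrt ((Tfun l k)^2 - 4*Dfun l k))/2 - 2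

theorem Rsq_lt_one {l : ℝ} (hl : l ∈ Ioo (0 : ℝ) 1) : Rsq l < 1 := by
  have hlog : Real.log l < 0 := Real.log_neg hl.1 hl.2
  have h := Real.log_lt_sub_one_of_pos (pow_pos hl.1 2) (by nlinarith [hl.1, hl.2])
  rw [Real.log_pow] at h
  push_cast at h
  rw [Rsq, div_lt_one (by linarith)]
  linarith

theorem sq_lt_Rsq {l : ℝ} (hl : l ∈ Ioo (0 : ℝ) 1) : l ^ 2 < Rsq l := by
  have hlog : Real.log l < 0 := Real.log_neg hl.1 hl.2
  have hl2 : 0 < l ^ 2 := pow_pos hl.1 2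
  have hne : (l ^ 2)⁻¹ ≠ 1 := by
    rw [Ne, inv_eq_one]
    nlinarith [hl.1, hl.2]
  have h := mul_lt_mul_of_pos_left (Real.log_lt_sub_one_of_pos (inv_pos.2 hl2) hne) hl2
  rw [Real.log_inv, Real.log_pow, mul_sub, mul_inv_cancel₀ hl2.ne'] at h
  push_cast at h
  rw [Rsq, lt_div_iff₀ (by linarith)]
  linarith

theorem om_pos {l k : ℝ} (hl : l ∈ Ioo (0 : ℝ) 1) (hk : 0 < k) : 0 < om l k :=
  neg_pos.2 (mul_neg_of_pos_of_neg hk (Real.log_neg hl.1 hl.2))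

theorem strictMonoOn_mul_sinh_div_cosh :
    StrictMonoOn (fun x : ℝ => x * Real.sinh x / Real.cosh x) (Ioi 0) := by
  intro x hx y hy hxy
  have hx0 : 0 < x := hx
  have h : 0 < Real.sinh (y - x) := Real.sinh_pos_iff.2 (sub_pos.2 hxy)
  rw [Real.sinh_sub] at h
  have hpos : 0 < Real.sinh y * Real.cosh x :=
    mul_pos (Real.sinh_pos_iff.2 hy) (Real.cosh_pos x)
  simp only
  rw [div_lt_div_iff₀ (Real.cosh_pos x) (Real.cosh_pos y)]
  nlinarith [mul_pos hx0 h, mul_pos (sub_pos.2 hxy) hpos]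

theorem strictMonoOn_mul_cosh_div_sinh :
    StrictMonoOn (fun x : ℝ => x * Real.cosh x / Real.sinh x) (Ioi 0) := by
  have hd : ∀ x ∈ Ioi (0 : ℝ), HasDerivAt (fun x : ℝ => x * Real.cosh x / Real.sinh x)
      (((1 * Real.cosh x + x * Real.sinh x) * Real.sinh x - x * Real.cosh x * Real.cosh x) /
        Real.sinh x ^ 2) x := fun x hx =>
    ((hasDerivAt_id' x).mul (Real.hasDerivAt_cosh x)).div (Real.hasDerivAt_sinh x)
      (Real.sinh_pos_iff.2 hx).ne'
  refine strictMonoOn_of_deriv_pos (convex_Ioi 0)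
    (fun x hx => (hd x hx).continuousAt.continuousWithinAt) fun x hx => ?_
  rw [interior_Ioi] at hx
  rw [(hd x hx).deriv]
  have hs : 0 < Real.sinh x := Real.sinh_pos_iff.2 hx
  have hxs : x < Real.sinh x := Real.self_lt_sinh_iff.2 hx
  have hc : 1 ≤ Real.cosh x := Real.one_le_cosh x
  refine div_pos ?_ (pow_pos hs 2)
  have hcs : x * Real.cosh x ^ 2 = x * (Real.sinh x ^ 2 + 1) := by rw [Real.cosh_sq]
  nlinarith [mul_nonneg hs.le (sub_nonneg.2 hc)]

/-- For trace `t = (a + b) (u + v) / 2 + b - a` and determinant `d = a b (u v - 1)`, the change of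
the spectral gap `√(t² - 4d)` is smaller than that of `t` when `u` and `v` both increase. -/
theorem abs_sqrt_disc_sub_lt {a b u v u' v' : ℝ} (ha : 0 < a) (hb : 0 < b)
    (hu : u < u') (hv : v < v') :
    |√(((a + b) * ((u' + v') / 2) + b - a) ^ 2 - 4 * (a * b * (u' * v' - 1))) -
        √(((a + b) * ((u + v) / 2) + b - a) ^ 2 - 4 * (a * b * (u * v - 1)))| <
      (a + b) * ((u' + v') / 2) - (a + b) * ((u + v) / 2) := by
  have hab : √(a * b) ^ 2 = a * b := Real.sq_sqrt (mul_pos ha hb).le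
  have norm_mk (x y : ℝ) : ‖(⟨x, y⟩ : ℂ)‖ = √(x ^ 2 + y ^ 2) := by
    rw [Complex.norm_def, Complex.normSq_mk, sq, sq]
  have norm_eq (u v : ℝ) :
      ‖(⟨(a - b) * ((u + v) / 2) - (a + b), √(a * b) * (u - v)⟩ : ℂ)‖ =
        √(((a + b) * ((u + v) / 2) + b - a) ^ 2 - 4 * (a * b * (u * v - 1))) := by
    rw [norm_mk, mul_pow, hab]
    ring_nf
  rw [← norm_eq, ← norm_eq]
  refine (abs_norm_sub_norm_le _ _).trans_lt ?_
  rw [← mul_sub]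
  have hp : 0 < (u' + v') / 2 - (u + v) / 2 := by linarith
  have hsub (x y x' y' : ℝ) : (⟨x', y'⟩ : ℂ) - ⟨x, y⟩ = ⟨x' - x, y' - y⟩ := rfl
  rw [hsub, norm_mk, Real.sqrt_lt' (mul_pos (add_pos ha hb) hp), ← mul_sub, mul_pow (√(a * b)), hab]
  nlinarith [mul_pos (mul_pos ha hb) (mul_pos (sub_pos.2 hu) (sub_pos.2 hv))]

theorem mul_cothR_eq {l k : ℝ} (hl : l ∈ Ioo (0 : ℝ) 1) (hk : 0 < k) :
    k * cothR (om l k) =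
      (k * Real.cosh (om l k / 2) / Real.sinh (om l k / 2) +
        k * Real.sinh (om l k / 2) / Real.cosh (om l k / 2)) / 2 := by
  have hx := half_pos (om_pos hl hk)
  have hs := (Real.sinh_pos_iff.2 hx).ne'
  have hc := (Real.cosh_pos (om l k / 2)).ne'
  have h2 : om l k = 2 * (om l k / 2) := by ring
  rw [cothR]
  nth_rewrite 1 2 [h2]
  rw [Real.cosh_two_mul, Real.sinh_two_mul]
  field_simp

theorem strictMonoOn_mul_comp_om {l : ℝ} (hl : l ∈ Ioo (0 : ℝ) 1) {f g : ℝ → ℝ}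
    (h : StrictMonoOn (fun x => x * f x / g x) (Ioi 0)) :
    StrictMonoOn (fun k => k * f (om l k / 2) / g (om l k / 2)) (Ioi 0) := by
  have hL : 0 < -Real.log l / 2 := half_pos (neg_pos.2 (Real.log_neg hl.1 hl.2))
  have hom (k : ℝ) : om l k / 2 = -Real.log l / 2 * k := by rw [om]; ring
  intro x hx y hy hxy
  have key := h (mul_pos hL hx) (mul_pos hL hy) (mul_lt_mul_of_pos_left hxy hL)
  simp only [mul_assoc, mul_div_assoc] at key
  simp only [hom, mul_div_assoc] at key ⊢
  exact lt_of_mul_lt_mul_left key (by linarith)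

theorem abs_sqrt_disc_sub_lt_Tfun_sub {l k k' : ℝ} (hl : l ∈ Ioo (0 : ℝ) 1) (hk : 0 < k)
    (hkk' : k < k') :
    |√(Tfun l k' ^ 2 - 4 * Dfun l k') - √(Tfun l k ^ 2 - 4 * Dfun l k)| <
      Tfun l k' - Tfun l k := by
  have hl2 : 0 < l ^ 2 := pow_pos hl.1 2
  have hk' : 0 < k' := hk.trans hkk'
  have ha : 0 < Rsq l / l ^ 2 - 1 := sub_pos.2 ((one_lt_div hl2).2 (sq_lt_Rsq hl))
  have hb : 0 < 1 - Rsq l := sub_pos.2 (Rsq_lt_one hl)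
  let U (k : ℝ) : ℝ := k * Real.cosh (om l k / 2) / Real.sinh (om l k / 2)
  let V (k : ℝ) : ℝ := k * Real.sinh (om l k / 2) / Real.cosh (om l k / 2)
  have hU : U k < U k' :=
    strictMonoOn_mul_comp_om hl strictMonoOn_mul_cosh_div_sinh hk hk' hkk'
  have hV : V k < V k' :=
    strictMonoOn_mul_comp_om hl strictMonoOn_mul_sinh_div_cosh hk hk' hkk'
  have hT {k : ℝ} (hk : 0 < k) : Tfun l k =
      (Rsq l / l ^ 2 - 1 + (1 - Rsq l)) * ((U k + V k) / 2) + (1 - Rsq l) -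
        (Rsq l / l ^ 2 - 1) := by
    rw [← mul_cothR_eq hl hk, Tfun]
    ring
  have hD {k : ℝ} (hk : 0 < k) :
      Dfun l k = (Rsq l / l ^ 2 - 1) * (1 - Rsq l) * (U k * V k - 1) := by
    have hx := half_pos (om_pos hl hk)
    have hs := (Real.sinh_pos_iff.2 hx).ne'
    have hc := (Real.cosh_pos (om l k / 2)).ne'
    have hUV : U k * V k = k ^ 2 := by
      simp only [U, V]
      field_simp
    rw [hUV, Dfun]
  rw [hT hk, hT hk', hD hk, hD hk']
  have := abs_sqrt_disc_sub_lt ha hb hU hV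
  linarith

/-- for every fixed `λ ∈ (0,1)`, the eigenvalues `k ↦ μ₁(λ,k)` and
`k ↦ μ₂(λ,k)` are strictly increasing on `(0,∞)`. -/
theorem eigenvalues_strictMono_in_k :
    ∀ l ∈ Ioo (0:ℝ) 1,
      StrictMonoOn (fun k => mu1 l k) (Ioi (0:ℝ)) ∧
      StrictMonoOn (fun k => mu2 l k) (Ioi (0:ℝ)) := by
  intro l hl
  constructor
  · intro k hk k' _ hkk'
    have h := (abs_lt.1 (abs_sqrt_disc_sub_lt_Tfun_sub hl hk hkk')).2
    simp only [mu1]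
    linarith
  · intro k hk k' _ hkk'
    have h := (abs_lt.1 (abs_sqrt_disc_sub_lt_Tfun_sub hl hk hkk')).1
    simp only [mu2]
    linarith
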